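/- arXiv:1409.4750 — 3 statements merged into one kernel-verified Lean document; each statement's English description precedes it below -/
import Mathlib

section
/- Let m ≥ 1, let a ∈ ℤ^m be nonzero, and let c ∈ ℂ with |c| < 1. Then the integral over the cube [0,2π]^m (with Lebesgue measure) of the function u ↦ log(1 + c · exp(i (a_1 u_1 + … + a_m u_m))) equals 0, where log denotes the principal branch of the complex logarithm (defined since the argument has positive real part). -/
open MeasureTheory

lemma integral_Icc_exp_int_mul_I {k : ℤ} (hk : k ≠ 0) :
    ∫ t in Set.Icc (0 : ℝ) (2 * Real.pi), Complex.exp (Complex.I * k * t) = 0 := by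
  have hk' : Complex.I * (k : ℂ) ≠ 0 := mul_ne_zero Complex.I_ne_zero (by exact_mod_cast hk)
  rw [integral_Icc_eq_integral_Ioc, ← intervalIntegral.integral_of_le Real.two_pi_pos.le,
    integral_exp_mul_complex hk']
  have h : Complex.exp (Complex.I * k * ((2 * Real.pi : ℝ) : ℂ)) = 1 := by
    rw [← Complex.exp_int_mul_two_pi_mul_I k]
    push_cast
    ring_nf
  rw [h]
  simp

lemma integral_cube_character_eq_zero {ι : Type*} [Fintype ι] {a : ι → ℤ} (ha : a ≠ 0) :
    ∫ u in Set.Icc (0 : ι → ℝ) (fun _ => 2 * Real.pi),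
      Complex.exp (Complex.I * ∑ j, (a j : ℂ) * (u j : ℂ)) = 0 := by
  obtain ⟨j, hj⟩ := Function.ne_iff.mp ha
  simp_rw [← Set.pi_univ_Icc, volume_pi, Measure.restrict_pi_pi, Finset.mul_sum, Complex.exp_sum,
    ← mul_assoc]
  rw [integral_fintype_prod_eq_prod (fun i (t : ℝ) => Complex.exp (Complex.I * a i * t))]
  exact Finset.prod_eq_zero (Finset.mem_univ j) (integral_Icc_exp_int_mul_I hj)

/-- Vanishing of the wall-crossing integral: for `a ∈ ℤ^m` nonzero and `|c| < 1`,
the integral over the cube `[0,2π]^m` of `log (1 + c·exp(i⟨a,u⟩))` (principal branch,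
defined since the argument has positive real part) is zero. -/
theorem integral_log_one_add_character_eq_zero (m : ℕ) (hm : 1 ≤ m)
    (a : Fin m → ℤ) (ha : a ≠ 0) (c : ℂ) (hc : ‖c‖ < 1) :
    (∫ u in Set.Icc (0 : Fin m → ℝ) (fun _ => 2 * Real.pi),
        Complex.log (1 + c * Complex.exp (Complex.I * ∑ j : Fin m, (a j : ℂ) * (u j : ℂ))))
      = 0 := by
  have hnorm (u : Fin m → ℝ) :
      ‖c * Complex.exp (Complex.I * ∑ j, (a j : ℂ) * (u j : ℂ))‖ = ‖c‖ := by
    have h : Complex.I * ∑ j, (a j : ℂ) * (u j : ℂ) =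
        ((∑ j, (a j : ℝ) * u j : ℝ) : ℂ) * Complex.I := by
      push_cast
      ring
    rw [norm_mul, h, Complex.norm_exp_ofReal_mul_I, mul_one]
  have hfin : IsFiniteMeasure
      (volume.restrict (Set.Icc (0 : Fin m → ℝ) (fun _ => 2 * Real.pi))) :=
    ⟨by simpa using isCompact_Icc.measure_lt_top⟩
  have hsum := hasSum_integral_of_dominated_convergence
    (μ := volume.restrict (Set.Icc (0 : Fin m → ℝ) (fun _ => 2 * Real.pi)))
    (F := fun (n : ℕ) u => (-1) ^ (n + 1) *
      (c * Complex.exp (Complex.I * ∑ j, (a j : ℂ) * (u j : ℂ))) ^ n / n)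
    (fun n _ => ‖c‖ ^ n)
    (fun n => (by fun_prop : Continuous _).aestronglyMeasurable)
    (fun n => .of_forall fun u => by
      rw [norm_div, norm_mul, norm_pow, norm_pow, hnorm]
      rcases Nat.eq_zero_or_pos n with rfl | hn
      · simp
      · simpa using div_le_self (by positivity) (by exact_mod_cast hn))
    (.of_forall fun _ => summable_geometric_of_lt_one (norm_nonneg c) hc)
    (integrable_const _)
    (.of_forall fun u => Complex.hasSum_taylorSeries_log ((hnorm u).trans_lt hc))
  refine hsum.unique ?_
  refine hasSum_zero.congr_fun fun n => ?_
  rcases eq_or_ne n 0 with rfl | hn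
  · simp
  have hna : (n : ℤ) • a ≠ 0 := smul_ne_zero (by exact_mod_cast hn) ha
  have hterm (u : Fin m → ℝ) : (-1 : ℂ) ^ (n + 1) *
      (c * Complex.exp (Complex.I * ∑ j, (a j : ℂ) * (u j : ℂ))) ^ n / n =
      ((-1) ^ (n + 1) * c ^ n / n) *
        Complex.exp (Complex.I * ∑ j, (((n : ℤ) • a) j : ℂ) * (u j : ℂ)) := by
    have h : Complex.I * ∑ j, (((n : ℤ) • a) j : ℂ) * (u j : ℂ) =
        n * (Complex.I * ∑ j, (a j : ℂ) * (u j : ℂ)) := by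
      simp only [Pi.smul_apply, smul_eq_mul, Int.cast_mul, Int.cast_natCast, mul_assoc,
        ← Finset.mul_sum]
      ring
    rw [h, Complex.exp_nat_mul]
    ring
  simp_rw [hterm]
  rw [integral_const_mul, integral_cube_character_eq_zero hna, mul_zero]
end

section
/- Let R be a commutative ring and f ∈ R. Let S = R[Z_+, Z_-]/(Z_+Z_- − f). Then the localization of S at the multiplicative set of powers of (the image of) Z_+ is isomorphic as an R-algebra to the Laurent polynomial ring R[Z, Z^{-1}], under the map sending Z_+ to Z and Z_- to f·Z^{-1}. -/
open MvPolynomial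

/-- The slab chart ring `R[Z₊,Z₋]/(Z₊Z₋ − f)`. -/
abbrev SlabRing (R : Type*) [CommRing R] (f : R) : Type _ :=
  MvPolynomial (Fin 2) R ⧸ Ideal.span {(X 0 : MvPolynomial (Fin 2) R) * X 1 - C f}

namespace SlabRing

variable {R : Type*} [CommRing R] (f : R)

/-- The image of `Z₊` in the slab chart ring. -/
noncomputable abbrev Zplus : SlabRing R f := Ideal.Quotient.mk _ (X 0)

/-- The image of `Z₋` in the slab chart ring. -/
noncomputable abbrev Zminus : SlabRing R f := Ideal.Quotient.mk _ (X 1)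

theorem Zplus_mul_Zminus : Zplus f * Zminus f = algebraMap R (SlabRing R f) f := by
  have h := Ideal.Quotient.eq.mpr
    (Ideal.mem_span_singleton_self ((X 0 : MvPolynomial (Fin 2) R) * X 1 - C f))
  rw [map_mul] at h
  exact h

/-- The chart homomorphism `Z₊ ↦ Z`, `Z₋ ↦ f·Z⁻¹`. -/
noncomputable def toLaurent : SlabRing R f →ₐ[R] LaurentPolynomial R :=
  Ideal.Quotient.liftₐ _
    (aeval ![LaurentPolynomial.T 1, LaurentPolynomial.C f * LaurentPolynomial.T (-1)]) <| by
    intro a ha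
    rw [← RingHom.mem_ker]
    refine (Ideal.span_singleton_le_iff_mem _).mpr ?_ ha
    rw [RingHom.mem_ker, map_sub, map_mul, aeval_X, aeval_X, aeval_C, sub_eq_zero]
    change LaurentPolynomial.T 1 * (LaurentPolynomial.C f * LaurentPolynomial.T (-1)) = _
    rw [mul_left_comm, ← LaurentPolynomial.T_add, add_neg_cancel, LaurentPolynomial.T_zero,
      mul_one, LaurentPolynomial.C_eq_algebraMap]

theorem toLaurent_Zplus : toLaurent f (Zplus f) = LaurentPolynomial.T 1 :=
  aeval_X _ 0

theorem toLaurent_Zminus :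
    toLaurent f (Zminus f) = LaurentPolynomial.C f * LaurentPolynomial.T (-1) :=
  aeval_X _ 1

/-- The extension of `SlabRing.toLaurent` to the localization at the powers of `Z₊`. -/
noncomputable def awayToLaurent : Localization.Away (Zplus f) →ₐ[R] LaurentPolynomial R :=
  IsLocalization.liftAlgHom (M := Submonoid.powers (Zplus f)) (f := toLaurent f) <| by
    rintro ⟨_, n, rfl⟩
    simp only [map_pow, toLaurent_Zplus]
    exact (LaurentPolynomial.isUnit_T 1).pow n

theorem awayToLaurent_algebraMap (s : SlabRing R f) :
    awayToLaurent f (algebraMap _ _ s) = toLaurent f s :=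
  IsLocalization.lift_eq _ s

/-- `Z₊` as a unit of the localization at its powers. -/
noncomputable def unitZplus : (Localization.Away (Zplus f))ˣ :=
  (IsLocalization.Away.algebraMap_isUnit (S := Localization.Away (Zplus f)) (Zplus f)).unit

theorem val_unitZplus : (unitZplus f : Localization.Away (Zplus f)) = algebraMap _ _ (Zplus f) :=
  rfl

/-- The homomorphism `Z ↦ Z₊` from Laurent polynomials to the localization at the powers
of `Z₊`. -/
noncomputable def ofLaurent : LaurentPolynomial R →ₐ[R] Localization.Away (Zplus f) where
  toRingHom := LaurentPolynomial.eval₂ (algebraMap R _) (unitZplus f)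
  commutes' r := by
    rw [← LaurentPolynomial.C_eq_algebraMap]
    exact LaurentPolynomial.eval₂_C _ _ r

theorem ofLaurent_T (n : ℤ) : ofLaurent f (LaurentPolynomial.T n) = (unitZplus f ^ n).val :=
  LaurentPolynomial.eval₂_T _ _ n

theorem awayToLaurent_ofLaurent (p : LaurentPolynomial R) :
    awayToLaurent f (ofLaurent f p) = p := by
  have hpow (n : ℕ) : awayToLaurent f (ofLaurent f (LaurentPolynomial.T n)) =
      LaurentPolynomial.T n := by
    rw [ofLaurent_T, zpow_natCast, Units.val_pow_eq_pow_val, map_pow, val_unitZplus,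
      awayToLaurent_algebraMap, toLaurent_Zplus, LaurentPolynomial.T_pow, mul_one]
  induction p using LaurentPolynomial.induction_on_mul_T with
  | _ q n =>
  refine (LaurentPolynomial.isUnit_T (n : ℤ)).mul_left_injective ?_
  dsimp only
  nth_rw 1 [← hpow n]
  rw [← map_mul, ← map_mul, LaurentPolynomial.mul_T_assoc, neg_add_cancel,
    LaurentPolynomial.T_zero, mul_one]
  induction q using Polynomial.induction_on' with
  | add p q hp hq => simp only [map_add, hp, hq]
  | monomial m r =>
    rw [← Polynomial.C_mul_X_pow_eq_monomial, Polynomial.toLaurent_C_mul_X_pow, map_mul, map_mul,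
      hpow, LaurentPolynomial.C_eq_algebraMap, AlgHom.commutes, AlgHom.commutes]

theorem ofLaurent_comp_awayToLaurent :
    (ofLaurent f).comp (awayToLaurent f) = AlgHom.id R _ := by
  refine IsLocalization.algHom_ext (Submonoid.powers (Zplus f)) ?_
  refine Ideal.Quotient.algHom_ext _ (MvPolynomial.algHom_ext fun i => ?_)
  change ofLaurent f (awayToLaurent f (algebraMap (SlabRing R f) _ (Ideal.Quotient.mk _ (X i)))) =
    algebraMap (SlabRing R f) _ (Ideal.Quotient.mk _ (X i))
  rw [awayToLaurent_algebraMap]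
  fin_cases i
  · change ofLaurent f (toLaurent f (Zplus f)) = algebraMap _ _ (Zplus f)
    rw [toLaurent_Zplus, ofLaurent_T, zpow_one, val_unitZplus]
  · change ofLaurent f (toLaurent f (Zminus f)) = algebraMap _ _ (Zminus f)
    rw [toLaurent_Zminus, map_mul, ofLaurent_T, zpow_neg_one, LaurentPolynomial.C_eq_algebraMap,
      AlgHom.commutes, Units.mul_inv_eq_iff_eq_mul, val_unitZplus, ← map_mul, mul_comm (Zminus f),
      Zplus_mul_Zminus, ← IsScalarTower.algebraMap_apply]

/-- The localization of the slab chart ring at the powers of `Z₊` is the Laurent polynomial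
ring. -/
noncomputable def awayEquivLaurent : Localization.Away (Zplus f) ≃ₐ[R] LaurentPolynomial R :=
  AlgEquiv.ofAlgHom (awayToLaurent f) (ofLaurent f)
    (AlgHom.ext (awayToLaurent_ofLaurent f)) (ofLaurent_comp_awayToLaurent f)

end SlabRing

/-- Let `S = R[Z₊,Z₋]/(Z₊Z₋ − f)`. The localization of `S` at the powers of `Z₊` is
isomorphic as an `R`-algebra to the Laurent polynomial ring `R[Z,Z⁻¹]`, under the map
sending `Z₊` to `Z` and `Z₋` to `f·Z⁻¹`. -/
theorem localization_slab_chart_away_Zplus (R : Type*) [CommRing R] (f : R) :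
    ∃ e : Localization.Away
            (Ideal.Quotient.mk
              (Ideal.span {(X 0 : MvPolynomial (Fin 2) R) * X 1 - C f}) (X 0))
          ≃ₐ[R] LaurentPolynomial R,
      e (algebraMap _ _
          (Ideal.Quotient.mk
            (Ideal.span {(X 0 : MvPolynomial (Fin 2) R) * X 1 - C f}) (X 0)))
        = LaurentPolynomial.T 1 ∧
      e (algebraMap _ _
          (Ideal.Quotient.mk
            (Ideal.span {(X 0 : MvPolynomial (Fin 2) R) * X 1 - C f}) (X 1)))
        = LaurentPolynomial.C f * LaurentPolynomial.T (-1) := by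
  exact ⟨SlabRing.awayEquivLaurent f,
    (SlabRing.awayToLaurent_algebraMap f _).trans (SlabRing.toLaurent_Zplus f),
    (SlabRing.awayToLaurent_algebraMap f _).trans (SlabRing.toLaurent_Zminus f)⟩
end

section
/- For all positive integers p and q, the Lebesgue measure of the set {x ∈ [0,1] : ⌊px⌋ + ⌊qx⌋ + 1 = ⌊(p+q)x⌋} equals 1/2. -/
open MeasureTheory

theorem ae_mul_ne_intCast {c : ℝ} (hc : c ≠ 0) : ∀ᵐ x : ℝ, ∀ n : ℤ, c * x ≠ n := by
  rw [ae_all_iff]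
  intro n
  filter_upwards [Measure.ae_ne volume ((n : ℝ) / c)] with x hx h
  exact hx (by rw [← h]; field_simp)

theorem floor_mul_one_sub {x : ℝ} (c : ℕ) (h : ∀ n : ℤ, (c : ℝ) * x ≠ n) :
    ⌊(c : ℝ) * (1 - x)⌋ = c - 1 - ⌊(c : ℝ) * x⌋ := by
  have h₁ := lt_of_le_of_ne (Int.floor_le ((c : ℝ) * x)) (h _).symm
  have h₂ := Int.lt_floor_add_one ((c : ℝ) * x)
  rw [Int.floor_eq_iff]
  push_cast
  constructor <;> linarith

/-- For all positive integers `p` and `q`, the Lebesgue measure of the set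
`{x ∈ [0,1] : ⌊px⌋ + ⌊qx⌋ + 1 = ⌊(p+q)x⌋}` equals `1/2`. -/
theorem measure_floor_sum_eq_half (p q : ℕ) (hp : 0 < p) (hq : 0 < q) :
    volume {x : ℝ | x ∈ Set.Icc (0 : ℝ) 1 ∧
        ⌊(p : ℝ) * x⌋ + ⌊(q : ℝ) * x⌋ + 1 = ⌊((p : ℝ) + (q : ℝ)) * x⌋}
      = 1 / 2 := by
  set A := {x : ℝ | x ∈ Set.Icc (0 : ℝ) 1 ∧
    ⌊(p : ℝ) * x⌋ + ⌊(q : ℝ) * x⌋ + 1 = ⌊((p : ℝ) + (q : ℝ)) * x⌋} with hA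
  have hmeas : MeasurableSet A :=
    measurableSet_Icc.inter (measurableSet_eq_fun (by fun_prop) (by fun_prop))
  have hreflect : (fun x : ℝ => 1 - x) ⁻¹' A =ᵐ[volume] (Set.Icc 0 1 \ A : Set ℝ) := by
    rw [Filter.eventuallyEq_set]
    filter_upwards [ae_mul_ne_intCast (c := (p : ℝ)) (by positivity),
      ae_mul_ne_intCast (c := (q : ℝ)) (by positivity),
      ae_mul_ne_intCast (c := ((p + q : ℕ) : ℝ)) (by positivity)] with x h₁ h₂ h₃
    have e₃ := floor_mul_one_sub _ h₃
    push_cast at e₃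
    have hIcc : 1 - x ∈ Set.Icc (0 : ℝ) 1 ↔ x ∈ Set.Icc (0 : ℝ) 1 := by
      simp only [Set.mem_Icc]
      constructor <;> rintro ⟨_, _⟩ <;> constructor <;> linarith
    have hle := Int.le_floor_add ((p : ℝ) * x) ((q : ℝ) * x)
    have hge := Int.le_floor_add_floor ((p : ℝ) * x) ((q : ℝ) * x)
    rw [← add_mul] at hle hge
    simp only [hA, Set.mem_preimage, Set.mem_sdiff, Set.mem_ofPred_eq, hIcc,
      floor_mul_one_sub _ h₁, floor_mul_one_sub _ h₂, e₃]
    by_cases hx : x ∈ Set.Icc (0 : ℝ) 1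
    · simp only [hx, true_and]
      omega
    · simp only [hx, false_and]
  have hsymm : volume (Set.Icc 0 1 \ A : Set ℝ) = volume A := by
    rw [← measure_congr hreflect]
    exact (Measure.measurePreserving_sub_left volume (1 : ℝ)).measure_preimage hmeas.nullMeasurableSet
  have hsum := measure_inter_add_sdiff (μ := volume) (Set.Icc (0 : ℝ) 1) hmeas
  rw [Set.inter_eq_right.mpr fun x hx => hx.1, hsymm, Real.volume_Icc, sub_zero,
    ENNReal.ofReal_one, ← two_mul] at hsum
  rw [ENNReal.eq_div_iff two_ne_zero ENNReal.ofNat_ne_top, hsum]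
end
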